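/- arXiv:2007.15047 — 7 statements merged into one kernel-verified Lean document; each statement's English description precedes it below -/
import Mathlib

section
/- Let A and B be nonempty finite types, let V := A × B × (A → B), and let T := {(x, y, f) ∈ V : f(x) = y}. Let μ be a probability mass function on A × B and, for each a ∈ A, let ν_a be a probability mass function on B. Let C be the set of probability mass functions P̂ on V whose marginal on the first two coordinates equals μ and, for each a ∈ A, whose marginal under the map (x, y, f) ↦ f(a) equals ν_a. Define S(P̂) := P̂(T). If there exists P̂ ∈ C with S(P̂) > 0, then the optimal value of the min–min problem inf_{P̂ ∈ C} inf_{P̃ supported in T} D(P̃‖P̂) equals −log( sup_{P̂ ∈ C} S(P̂) ), the supremum is attained, and P̂ ∈ C attains the outer infimum if and only if P̂ maximizes S over C. -/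
open scoped Classical

/-- A probability mass function on a finite type: nonnegative and summing to 1. -/
def IsPMF {α : Type*} [Fintype α] (P : α → ℝ) : Prop :=
  (∀ x, 0 ≤ P x) ∧ ∑ x, P x = 1

/-- Relative entropy (KL divergence) with values in `EReal`:
`D(P‖Q) = ∑_{x : P x > 0} P x * log (P x / Q x)` if `supp P ⊆ supp Q`, and `⊤` otherwise. -/
noncomputable def KL {α : Type*} [Fintype α] (P Q : α → ℝ) : EReal :=
  if {x | 0 < P x} ⊆ {x | 0 < Q x} then
    (((∑ x ∈ Finset.univ.filter (fun x => 0 < P x), P x * Real.log (P x / Q x)) : ℝ) : EReal)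
  else ⊤

/-- The support set `T = {(x, y, f) : f x = y}` of the consistent distributions for the
causal model `X → Y`. -/
def consistentSupport (A B : Type*) : Set (A × B × (A → B)) :=
  {v | v.2.2 v.1 = v.2.1}

/-- `S(P̂) = P̂(T)`, the mass that `P̂` puts on the consistent support set. -/
noncomputable def massOnT {A B : Type*} [Fintype A] [Fintype B]
    (P : A × B × (A → B) → ℝ) : ℝ :=
  ∑ v ∈ Finset.univ.filter (· ∈ consistentSupport A B), P v

/-- The constraint set `C`: pmfs on `V = A × B × (A → B)` whose `(X, Y)`-marginal is `μ` and
whose marginal under `(x, y, f) ↦ f a` is `ν a`, for every `a`. -/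
def constraintSet {A B : Type*} [Fintype A] [Fintype B]
    (μ : A × B → ℝ) (ν : A → B → ℝ) : Set (A × B × (A → B) → ℝ) :=
  {P | IsPMF P ∧
    (∀ (x : A) (y : B),
      (∑ v ∈ Finset.univ.filter
          (fun v : A × B × (A → B) => v.1 = x ∧ v.2.1 = y), P v) = μ (x, y)) ∧
    (∀ (a : A) (b : B),
      (∑ v ∈ Finset.univ.filter
          (fun v : A × B × (A → B) => v.2.2 a = b), P v) = ν a b)}

/-- The inner infimum `inf_{P̃ pmf supported in T} D(P̃‖P̂)`. -/
noncomputable def innerInf {A B : Type*} [Fintype A] [Fintype B]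
    (Phat : A × B × (A → B) → ℝ) : EReal :=
  sInf {d : EReal | ∃ Ptilde : A × B × (A → B) → ℝ,
    IsPMF Ptilde ∧ {v | 0 < Ptilde v} ⊆ consistentSupport A B ∧ d = KL Ptilde Phat}

/-- Gibbs inequality: if `P` is a pmf carried by `T` and
`supp P ⊆ supp Q`, then `D(P‖Q) ≥ -log Q(T)`. -/
lemma neg_log_mass_le_sum_mul_log {α : Type*} [Fintype α] {P Q : α → ℝ} {T : Set α}
    (hP : IsPMF P) (hQ : ∀ x, 0 ≤ Q x) (hPT : {x | 0 < P x} ⊆ T)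
    (hPQ : {x | 0 < P x} ⊆ {x | 0 < Q x})
    (hs : 0 < ∑ x ∈ Finset.univ.filter (· ∈ T), Q x) :
    -Real.log (∑ x ∈ Finset.univ.filter (· ∈ T), Q x) ≤
      ∑ x ∈ Finset.univ.filter (fun x => 0 < P x), P x * Real.log (P x / Q x) := by
  set s := ∑ x ∈ Finset.univ.filter (· ∈ T), Q x with hs_def
  have hP1 : ∑ x ∈ Finset.univ.filter (fun x => 0 < P x), P x = 1 := by
    rw [← hP.2]
    refine Finset.sum_subset (Finset.filter_subset _ _) fun x _ hx => ?_
    have hx' : ¬ 0 < P x := by simpa using hx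
    exact le_antisymm (not_lt.mp hx') (hP.1 x)
  have hQs : ∑ x ∈ Finset.univ.filter (fun x => 0 < P x), Q x ≤ s := by
    refine Finset.sum_le_sum_of_subset_of_nonneg (fun x hx => ?_) fun x _ _ => hQ x
    simp only [Finset.mem_filter, Finset.mem_univ, true_and] at hx ⊢
    exact hPT hx
  have hterm : ∀ x ∈ Finset.univ.filter (fun x => 0 < P x),
      P x - Q x / s - P x * Real.log s ≤ P x * Real.log (P x / Q x) := by
    intro x hx
    have hp : 0 < P x := by simpa using hx
    have hq : 0 < Q x := hPQ hp
    have hlog := Real.log_le_sub_one_of_pos (show 0 < Q x / (s * P x) by positivity)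
    rw [Real.log_div hq.ne' (by positivity), Real.log_mul hs.ne' hp.ne'] at hlog
    rw [Real.log_div hp.ne' hq.ne']
    have hmul := mul_le_mul_of_nonneg_left hlog hp.le
    have hcancel : P x * (Q x / (s * P x) - 1) = Q x / s - P x := by
      field_simp
    rw [hcancel] at hmul
    linarith
  have hsum := Finset.sum_le_sum hterm
  rw [Finset.sum_sub_distrib, Finset.sum_sub_distrib, ← Finset.sum_mul, ← Finset.sum_div,
    hP1] at hsum
  have hdiv := (div_le_one hs).mpr hQs
  linarith

/-- The conditional distribution of `Q` given `T` has relative entropy `-log Q(T)`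
with respect to `Q`. -/
lemma exists_pmf_KL_eq_neg_log_mass {α : Type*} [Fintype α] {Q : α → ℝ} {T : Set α}
    (hQ : ∀ x, 0 ≤ Q x) (hs : 0 < ∑ x ∈ Finset.univ.filter (· ∈ T), Q x) :
    ∃ P : α → ℝ, IsPMF P ∧ {x | 0 < P x} ⊆ T ∧
      KL P Q = ((-Real.log (∑ x ∈ Finset.univ.filter (· ∈ T), Q x) : ℝ) : EReal) := by
  set s := ∑ x ∈ Finset.univ.filter (· ∈ T), Q x with hs_def
  have hpos : ∀ x, 0 < (if x ∈ T then Q x / s else 0) → x ∈ T ∧ 0 < Q x := by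
    intro x hx
    by_cases hT : x ∈ T
    · rw [if_pos hT] at hx
      exact ⟨hT, (div_pos_iff_of_pos_right hs).mp hx⟩
    · simp [hT] at hx
  have hpmf : IsPMF (fun x => if x ∈ T then Q x / s else 0) := by
    refine ⟨fun x => ?_, ?_⟩
    · dsimp only
      split_ifs
      · exact div_nonneg (hQ x) hs.le
      · exact le_rfl
    · rw [← Finset.sum_filter, ← Finset.sum_div, ← hs_def, div_self hs.ne']
  refine ⟨_, hpmf, fun x hx => (hpos x hx).1, ?_⟩
  have hsupp : {x | 0 < (if x ∈ T then Q x / s else 0)} ⊆ {x | 0 < Q x} :=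
    fun x hx => (hpos x hx).2
  rw [KL, if_pos hsupp, EReal.coe_eq_coe_iff]
  have hP1 : ∑ x ∈ Finset.univ.filter (fun x => 0 < (if x ∈ T then Q x / s else 0)),
      (if x ∈ T then Q x / s else 0) = 1 := by
    rw [← hpmf.2]
    refine Finset.sum_subset (Finset.filter_subset _ _) fun x _ hx => ?_
    have hx' : ¬ 0 < (if x ∈ T then Q x / s else 0) := by
      simpa only [Finset.mem_filter, Finset.mem_univ, true_and] using hx
    exact le_antisymm (not_lt.mp hx') (hpmf.1 x)
  rw [← one_mul (-Real.log s), ← hP1, Finset.sum_mul]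
  refine Finset.sum_congr rfl fun x hx => ?_
  obtain ⟨hT, hq⟩ := hpos x (by simpa only [Finset.mem_filter, Finset.mem_univ, true_and] using hx)
  simp only [if_pos hT]
  rw [div_div_cancel_left' hq.ne', Real.log_inv]

section InnerInf

variable {A B : Type*} [Fintype A] [Fintype B]

lemma massOnT_nonneg {P : A × B × (A → B) → ℝ} (hP : ∀ v, 0 ≤ P v) : 0 ≤ massOnT P :=
  Finset.sum_nonneg fun v _ => hP v

lemma innerInf_eq_top {P : A × B × (A → B) → ℝ} (hP : ∀ v, 0 ≤ P v) (h : massOnT P = 0) :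
    innerInf P = ⊤ := by
  refine sInf_eq_top.mpr ?_
  rintro _ ⟨R, hR, hRT, rfl⟩
  refine if_neg fun hRP => ?_
  obtain ⟨v, -, hv⟩ := Finset.exists_ne_zero_of_sum_ne_zero (hR.2.trans_ne one_ne_zero)
  have hRv : 0 < R v := lt_of_le_of_ne (hR.1 v) hv.symm
  have hPv : P v = 0 :=
    (Finset.sum_eq_zero_iff_of_nonneg fun w _ => hP w).mp h v (by simpa using hRT hRv)
  exact absurd hPv (ne_of_gt (hRP hRv))

lemma innerInf_eq_neg_log {P : A × B × (A → B) → ℝ} (hP : ∀ v, 0 ≤ P v) (h : 0 < massOnT P) :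
    innerInf P = ((-Real.log (massOnT P) : ℝ) : EReal) := by
  refine le_antisymm ?_ (le_sInf ?_)
  · obtain ⟨R, hR, hRT, hKL⟩ := exists_pmf_KL_eq_neg_log_mass hP h
    exact sInf_le ⟨R, hR, hRT, hKL.symm⟩
  · rintro _ ⟨R, hR, hRT, rfl⟩
    rw [KL]
    split_ifs with hRP
    · exact EReal.coe_le_coe_iff.mpr (neg_log_mass_le_sum_mul_log hR hP hRT hRP h)
    · exact le_top

lemma continuous_massOnT : Continuous (massOnT : (A × B × (A → B) → ℝ) → ℝ) :=
  continuous_finsetSum _ fun v _ => continuous_apply v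

lemma isCompact_constraintSet (μ : A × B → ℝ) (ν : A → B → ℝ) :
    IsCompact (constraintSet μ ν) := by
  refine (isCompact_stdSimplex ℝ (A × B × (A → B))).of_isClosed_subset ?_ fun P hP => hP.1
  have hcont (s : Finset (A × B × (A → B))) :
      Continuous fun P : A × B × (A → B) → ℝ => ∑ v ∈ s, P v :=
    continuous_finsetSum _ fun v _ => continuous_apply v
  have hxy : IsClosed (⋂ (x : A) (y : B), {P : A × B × (A → B) → ℝ |
      ∑ v ∈ Finset.univ.filter (fun v => v.1 = x ∧ v.2.1 = y), P v = μ (x, y)}) :=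
    isClosed_iInter fun _ => isClosed_iInter fun _ => isClosed_eq (hcont _) continuous_const
  have hf : IsClosed (⋂ (a : A) (b : B), {P : A × B × (A → B) → ℝ |
      ∑ v ∈ Finset.univ.filter (fun v => v.2.2 a = b), P v = ν a b}) :=
    isClosed_iInter fun _ => isClosed_iInter fun _ => isClosed_eq (hcont _) continuous_const
  convert (isClosed_stdSimplex ℝ (A × B × (A → B))).inter (hxy.inter hf) using 1
  ext P
  simp only [constraintSet, Set.mem_inter_iff, Set.mem_iInter, Set.mem_ofPred_eq]
  rfl

end InnerInf

/-- If some `P̂ ∈ C` has `S(P̂) > 0`, then the optimal value of the min–min problem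
`inf_{P̂ ∈ C} inf_{P̃ supported in T} D(P̃‖P̂)` equals `-log (sup_{P̂ ∈ C} S(P̂))`, the supremum
of `S` over `C` is attained, and `P̂ ∈ C` attains the outer infimum iff it maximizes `S` on `C`. -/
theorem minmin_eq_neg_log_sup
    {A B : Type*} [Fintype A] [Fintype B] [Nonempty A] [Nonempty B]
    (μ : A × B → ℝ) (hμ : IsPMF μ) (ν : A → B → ℝ) (hν : ∀ a, IsPMF (ν a))
    (hex : ∃ P ∈ constraintSet μ ν, 0 < massOnT P) :
    (sSup (massOnT '' constraintSet μ ν) ∈ massOnT '' constraintSet μ ν) ∧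
    (sInf {d : EReal | ∃ P ∈ constraintSet μ ν, d = innerInf P}
      = ((-Real.log (sSup (massOnT '' constraintSet μ ν)) : ℝ) : EReal)) ∧
    (∀ P ∈ constraintSet μ ν,
      (innerInf P = sInf {d : EReal | ∃ P' ∈ constraintSet μ ν, d = innerInf P'})
        ↔ (∀ P' ∈ constraintSet μ ν, massOnT P' ≤ massOnT P)) := by
  obtain ⟨P₀, hP₀, hpos⟩ := hex
  obtain ⟨M, hM, hmax⟩ := (isCompact_constraintSet μ ν).exists_isMaxOn ⟨P₀, hP₀⟩
    continuous_massOnT.continuousOn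
  have hle : ∀ P ∈ constraintSet μ ν, massOnT P ≤ massOnT M := fun P hP => hmax hP
  have hMpos : 0 < massOnT M := hpos.trans_le (hle P₀ hP₀)
  have hsup : sSup (massOnT '' constraintSet μ ν) = massOnT M :=
    IsGreatest.csSup_eq ⟨⟨M, hM, rfl⟩, Set.forall_mem_image.mpr hle⟩
  have hinf : sInf {d : EReal | ∃ P ∈ constraintSet μ ν, d = innerInf P}
      = ((-Real.log (massOnT M) : ℝ) : EReal) := by
    refine le_antisymm (sInf_le ⟨M, hM, (innerInf_eq_neg_log hM.1.1 hMpos).symm⟩) (le_sInf ?_)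
    rintro _ ⟨P, hP, rfl⟩
    rcases (massOnT_nonneg hP.1.1).eq_or_lt with h | h
    · rw [innerInf_eq_top hP.1.1 h.symm]
      exact le_top
    · rw [innerInf_eq_neg_log hP.1.1 h, EReal.coe_le_coe_iff, neg_le_neg_iff]
      exact Real.log_le_log h (hle P hP)
  refine ⟨hsup ▸ ⟨M, hM, rfl⟩, hsup ▸ hinf, fun P hP => ?_⟩
  rw [hinf]
  constructor
  · intro heq P' hP'
    rcases (massOnT_nonneg hP.1.1).eq_or_lt with h | h
    · rw [innerInf_eq_top hP.1.1 h.symm] at heq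
      exact absurd heq.symm (EReal.coe_ne_top _)
    · rw [innerInf_eq_neg_log hP.1.1 h, EReal.coe_eq_coe_iff, neg_inj] at heq
      exact (hle P' hP').trans (Real.log_injOn_pos h hMpos heq).ge
  · intro hPmax
    have hPM : massOnT P = massOnT M := le_antisymm (hle P hP) (hPmax M hM)
    rw [innerInf_eq_neg_log hP.1.1 (hPM ▸ hMpos), hPM]
end

section
/- Let (Ω, 𝓕, ℙ) be a probability space, 𝒩 a measurable space, N : Ω → 𝒩 and X : Ω → {0,1} measurable and independent random variables, f : {0,1} × 𝒩 → {0,1} measurable in its second argument, and Y := f(X, N). Assume f is decreasing monotonic relative to X, i.e., f(1, n) ≤ f(0, n) for all n ∈ 𝒩. If ℙ(X = 0, Y = 1) > 0, then the probability of necessity PN_{0→1} := ℙ(f(1, N) = 0 | X = 0, Y = 1) satisfies PN_{0→1} = (ℙ(f(1, N) = 0) − ℙ(Y = 0)) / ℙ(X = 0, Y = 1). -/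
open MeasureTheory ProbabilityTheory

/-- In the SCM `Y = f(X, N)` with binary `X, Y` (`false = 0`, `true = 1`),
`X ⟂ N`, and `f` decreasing monotonic relative to `X` (`f 1 n ≤ f 0 n` for all `n`),
if `P(X = 0, Y = 1) > 0` then the probability of necessity
`PN₀→₁ = P(f(1, N) = 0 | X = 0, Y = 1)` equals
`(P(f(1, N) = 0) − P(Y = 0)) / P(X = 0, Y = 1)`. -/
theorem prob_necessity_decreasing
    {Ω 𝒩 : Type*} [MeasurableSpace Ω] [MeasurableSpace 𝒩]
    (P : Measure Ω) [IsProbabilityMeasure P]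
    (N : Ω → 𝒩) (X : Ω → Bool) (hN : Measurable N) (hX : Measurable X)
    (hIndep : IndepFun X N P)
    (f : Bool → 𝒩 → Bool) (hf : ∀ x, Measurable (f x))
    (Y : Ω → Bool) (hY : Y = fun ω => f (X ω) (N ω))
    (hMono : ∀ n, f true n ≤ f false n)
    (hpos : 0 < P {ω | X ω = false ∧ Y ω = true}) :
    P[|{ω | X ω = false ∧ Y ω = true}] {ω | f true (N ω) = false}
      = (P {ω | f true (N ω) = false} - P {ω | Y ω = false})
          / P {ω | X ω = false ∧ Y ω = true} := by
  have hYm : Measurable Y := by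
    have hYite : Y = fun ω => if X ω = false then f false (N ω) else f true (N ω) := by
      subst hY
      funext ω
      cases X ω <;> simp
    rw [hYite]
    exact Measurable.ite (hX (measurableSet_singleton false)) ((hf false).comp hN)
      ((hf true).comp hN)
  have hXY : MeasurableSet {ω | X ω = false ∧ Y ω = true} :=
    (hX (measurableSet_singleton false)).inter (hYm (measurableSet_singleton true))
  have hY0 : MeasurableSet {ω | Y ω = false} := hYm (measurableSet_singleton false)
  have hsub : {ω | Y ω = false} ⊆ {ω | f true (N ω) = false} := by
    intro ω hω
    replace hω : f (X ω) (N ω) = false := by rwa [hY] at hω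
    cases h : X ω with
    | false =>
      rw [h] at hω
      exact le_bot_iff.mp ((hMono (N ω)).trans hω.le)
    | true => rwa [h] at hω
  have hdiff : {ω | X ω = false ∧ Y ω = true} ∩ {ω | f true (N ω) = false}
      = {ω | f true (N ω) = false} \ {ω | Y ω = false} := by
    ext ω
    subst hY
    cases h : X ω <;> simp [h, and_comm]
  rw [cond_apply hXY, hdiff, measure_sdiff hsub hY0.nullMeasurableSet (measure_ne_top P _),
    ENNReal.div_eq_inv_mul]
end

section
/- Let (Ω, 𝓕, ℙ) be a probability space, 𝒩 a measurable space, N : Ω → 𝒩 and X : Ω → {0,1} measurable and independent random variables, f : {0,1} × 𝒩 → {0,1} measurable in its second argument, and Y := f(X, N). Assume f is decreasing monotonic relative to X, i.e., f(1, n) ≤ f(0, n) for all n ∈ 𝒩. If ℙ(X = 1, Y = 0) > 0, then the probability of sufficiency PS_{0→1} := ℙ(f(0, N) = 1 | X = 1, Y = 0) satisfies PS_{0→1} = (ℙ(Y = 0) − ℙ(f(0, N) = 0)) / ℙ(X = 1, Y = 0). -/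
open MeasureTheory ProbabilityTheory

/-- In the SCM `Y = f(X, N)` with binary `X, Y` (`false = 0`, `true = 1`),
`X ⟂ N`, and `f` decreasing monotonic relative to `X` (`f 1 n ≤ f 0 n` for all `n`),
if `P(X = 1, Y = 0) > 0` then the probability of sufficiency
`PS₀→₁ = P(f(0, N) = 1 | X = 1, Y = 0)` equals
`(P(Y = 0) − P(f(0, N) = 0)) / P(X = 1, Y = 0)`. -/
theorem prob_sufficiency_decreasing
    {Ω 𝒩 : Type*} [MeasurableSpace Ω] [MeasurableSpace 𝒩]
    (P : Measure Ω) [IsProbabilityMeasure P]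
    (N : Ω → 𝒩) (X : Ω → Bool) (hN : Measurable N) (hX : Measurable X)
    (hIndep : IndepFun X N P)
    (f : Bool → 𝒩 → Bool) (hf : ∀ x, Measurable (f x))
    (Y : Ω → Bool) (hY : Y = fun ω => f (X ω) (N ω))
    (hMono : ∀ n, f true n ≤ f false n)
    (hpos : 0 < P {ω | X ω = true ∧ Y ω = false}) :
    P[|{ω | X ω = true ∧ Y ω = false}] {ω | f false (N ω) = true}
      = (P {ω | Y ω = false} - P {ω | f false (N ω) = false})
          / P {ω | X ω = true ∧ Y ω = false} := by
  have hfN (x : Bool) : Measurable fun ω => f x (N ω) := (hf x).comp hN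
  have hYm : Measurable Y := by
    have hY' : Y = fun ω => if X ω = true then f true (N ω) else f false (N ω) := by
      subst hY
      funext ω
      cases X ω <;> simp
    rw [hY']
    exact Measurable.ite (hX (measurableSet_singleton true)) (hfN true) (hfN false)
  have hA : MeasurableSet {ω | X ω = true ∧ Y ω = false} :=
    (hX (measurableSet_singleton true)).inter (hYm (measurableSet_singleton false))
  have hB : MeasurableSet {ω | f false (N ω) = false} :=
    hfN false (measurableSet_singleton false)
  have hsub : {ω | f false (N ω) = false} ⊆ {ω | Y ω = false} := by
    intro ω (h : f false (N ω) = false)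
    simp only [hY, Set.mem_ofPred_eq]
    cases X ω
    · exact h
    · exact le_bot_iff.mp ((hMono (N ω)).trans_eq h)
  have hset : {ω | X ω = true ∧ Y ω = false} ∩ {ω | f false (N ω) = true}
      = {ω | Y ω = false} \ {ω | f false (N ω) = false} := by
    ext ω
    simp only [hY, Set.mem_inter_iff, Set.mem_sdiff, Set.mem_ofPred_eq]
    cases X ω <;> simp
  rw [cond_apply hA, hset, measure_sdiff hsub hB.nullMeasurableSet (measure_ne_top P _),
    ENNReal.div_eq_inv_mul]
end

section
/- Let (Ω, 𝓕, ℙ) be a probability space, 𝒩 a measurable space, N : Ω → 𝒩 and X : Ω → {0,1} measurable and independent random variables, f : {0,1} × 𝒩 → {0,1} measurable in its second argument, and Y := f(X, N). Assume f is decreasing monotonic relative to X, i.e., f(1, n) ≤ f(0, n) for all n ∈ 𝒩. Then the probability of necessity and sufficiency PNS_{0→1} := ℙ(X = 0, Y = 1, f(1, N) = 0) + ℙ(X = 1, Y = 0, f(0, N) = 1) satisfies PNS_{0→1} = ℙ(f(0, N) = 1) − ℙ(f(1, N) = 1); that is, PNS_{0→1} = ℙ^{do(X=0)}(Y = 1)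 − ℙ^{do(X=1)}(Y = 1). -/
open MeasureTheory ProbabilityTheory

/-- In the SCM `Y = f(X, N)` with binary `X, Y` (`false = 0`, `true = 1`),
`X ⟂ N`, and `f` decreasing monotonic relative to `X` (`f 1 n ≤ f 0 n` for all `n`),
the probability of necessity and sufficiency
`PNS₀→₁ = P(X = 0, Y = 1, f(1, N) = 0) + P(X = 1, Y = 0, f(0, N) = 1)` equals
`P(f(0, N) = 1) − P(f(1, N) = 1)`, i.e. `P^{do(X=0)}(Y = 1) − P^{do(X=1)}(Y = 1)`. -/
theorem pns_decreasing
    {Ω 𝒩 : Type*} [MeasurableSpace Ω] [MeasurableSpace 𝒩]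
    (P : Measure Ω) [IsProbabilityMeasure P]
    (N : Ω → 𝒩) (X : Ω → Bool) (hN : Measurable N) (hX : Measurable X)
    (hIndep : IndepFun X N P)
    (f : Bool → 𝒩 → Bool) (hf : ∀ x, Measurable (f x))
    (Y : Ω → Bool) (hY : Y = fun ω => f (X ω) (N ω))
    (hMono : ∀ n, f true n ≤ f false n) :
    P {ω | X ω = false ∧ Y ω = true ∧ f true (N ω) = false}
      + P {ω | X ω = true ∧ Y ω = false ∧ f false (N ω) = true}
      = P {ω | f false (N ω) = true} - P {ω | f true (N ω) = true} := by
  have hsub : {ω | f true (N ω) = true} ⊆ {ω | f false (N ω) = true} := fun ω h =>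
    hMono (N ω) h
  have hmeas : MeasurableSet {ω | f true (N ω) = true} :=
    ((hf true).comp hN) (measurableSet_singleton true)
  have hXmeas : MeasurableSet {ω | X ω = false} := hX (measurableSet_singleton false)
  rw [← measure_sdiff hsub hmeas.nullMeasurableSet (measure_ne_top P _),
    ← measure_inter_add_sdiff ({ω | f false (N ω) = true} \ {ω | f true (N ω) = true}) hXmeas]
  subst hY
  congr 2
  all_goals
    ext ω
    cases h : X ω <;> simp [h, and_comm]
end

section
/- Let (Ω, 𝓕, ℙ) be a probability space, 𝒩 a measurable space, N : Ω → 𝒩 and X : Ω → {0,1} measurable and independent random variables, f : {0,1} × 𝒩 → {0,1} measurable in its second argument, and Y := f(X, N). Assume f is increasing monotonic relative to X, i.e., f(0, n) ≤ f(1, n) for all n ∈ 𝒩. If ℙ(X = 1, Y = 1) > 0, then the probability of necessity PN_{1→1} := ℙ(f(0, N) = 0 | X = 1, Y = 1) satisfies PN_{1→1} = (ℙ(Y = 1) − ℙ(f(0, N) = 1)) / ℙ(X = 1, Y = 1). -/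
open MeasureTheory ProbabilityTheory

/-- In the SCM `Y = f(X, N)` with binary `X, Y` (`false = 0`, `true = 1`),
`X ⟂ N`, and `f` increasing monotonic relative to `X` (`f 0 n ≤ f 1 n` for all `n`),
if `P(X = 1, Y = 1) > 0` then the probability of necessity
`PN₁→₁ = P(f(0, N) = 0 | X = 1, Y = 1)` equals
`(P(Y = 1) − P(f(0, N) = 1)) / P(X = 1, Y = 1)`. -/
theorem prob_necessity_increasing
    {Ω 𝒩 : Type*} [MeasurableSpace Ω] [MeasurableSpace 𝒩]
    (P : Measure Ω) [IsProbabilityMeasure P]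
    (N : Ω → 𝒩) (X : Ω → Bool) (hN : Measurable N) (hX : Measurable X)
    (hIndep : IndepFun X N P)
    (f : Bool → 𝒩 → Bool) (hf : ∀ x, Measurable (f x))
    (Y : Ω → Bool) (hY : Y = fun ω => f (X ω) (N ω))
    (hMono : ∀ n, f false n ≤ f true n)
    (hpos : 0 < P {ω | X ω = true ∧ Y ω = true}) :
    P[|{ω | X ω = true ∧ Y ω = true}] {ω | f false (N ω) = false}
      = (P {ω | Y ω = true} - P {ω | f false (N ω) = true})
          / P {ω | X ω = true ∧ Y ω = true} := by
  subst hY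
  have hA : MeasurableSet {ω | f false (N ω) = true} :=
    (hf false).comp hN (measurableSet_singleton true)
  have hT : MeasurableSet {ω | f true (N ω) = true} :=
    (hf true).comp hN (measurableSet_singleton true)
  have hX1 : MeasurableSet {ω | X ω = true} := hX (measurableSet_singleton true)
  have hXY : {ω | X ω = true ∧ f (X ω) (N ω) = true}
      = {ω | X ω = true} ∩ {ω | f true (N ω) = true} := by
    ext ω
    simp +contextual
  have hsub : {ω | f false (N ω) = true} ⊆ {ω | f (X ω) (N ω) = true} := by
    intro ω hω
    change f (X ω) (N ω) = true
    cases X ω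
    · exact hω
    · exact Bool.le_iff_imp.1 (hMono (N ω)) hω
  have hdiff : {ω | X ω = true ∧ f (X ω) (N ω) = true} ∩ {ω | f false (N ω) = false}
      = {ω | f (X ω) (N ω) = true} \ {ω | f false (N ω) = true} := by
    ext ω
    cases hx : X ω <;> simp [hx]
  rw [cond_apply (hXY ▸ hX1.inter hT), hdiff,
    measure_sdiff hsub hA.nullMeasurableSet (measure_ne_top P _), ENNReal.div_eq_inv_mul]
end

section
/- Let (Ω, 𝓕, ℙ) be a probability space, 𝒩 a measurable space, N : Ω → 𝒩 and X : Ω → {0,1} measurable and independent random variables, f : {0,1} × 𝒩 → {0,1} measurable in its second argument, and Y := f(X, N). Assume f is increasing monotonic relative to X, i.e., f(0, n) ≤ f(1, n) for all n ∈ 𝒩. If ℙ(X = 0, Y = 0) > 0, then the probability of sufficiency PS_{1→1} := ℙ(f(1, N) = 1 | X = 0, Y = 0) satisfies PS_{1→1} = (ℙ(f(1, N) = 1) − ℙ(Y = 1)) / ℙ(X = 0, Y = 0). -/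
open MeasureTheory ProbabilityTheory

/-- In the SCM `Y = f(X, N)` with binary `X, Y` (`false = 0`, `true = 1`),
`X ⟂ N`, and `f` increasing monotonic relative to `X` (`f 0 n ≤ f 1 n` for all `n`),
if `P(X = 0, Y = 0) > 0` then the probability of sufficiency
`PS₁→₁ = P(f(1, N) = 1 | X = 0, Y = 0)` equals
`(P(f(1, N) = 1) − P(Y = 1)) / P(X = 0, Y = 0)`. -/
theorem prob_sufficiency_increasing
    {Ω 𝒩 : Type*} [MeasurableSpace Ω] [MeasurableSpace 𝒩]
    (P : Measure Ω) [IsProbabilityMeasure P]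
    (N : Ω → 𝒩) (X : Ω → Bool) (hN : Measurable N) (hX : Measurable X)
    (hIndep : IndepFun X N P)
    (f : Bool → 𝒩 → Bool) (hf : ∀ x, Measurable (f x))
    (Y : Ω → Bool) (hY : Y = fun ω => f (X ω) (N ω))
    (hMono : ∀ n, f false n ≤ f true n)
    (hpos : 0 < P {ω | X ω = false ∧ Y ω = false}) :
    P[|{ω | X ω = false ∧ Y ω = false}] {ω | f true (N ω) = true}
      = (P {ω | f true (N ω) = true} - P {ω | Y ω = true})
          / P {ω | X ω = false ∧ Y ω = false} := by
  have hYm : Measurable Y := by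
    have h : Measurable fun p : Bool × 𝒩 => f p.1 p.2 := measurable_from_prod_countable_right hf
    exact hY ▸ h.comp (hX.prodMk hN)
  have hYset : MeasurableSet {ω | Y ω = true} := hYm (measurableSet_singleton true)
  have hA : MeasurableSet {ω | X ω = false ∧ Y ω = false} :=
    (hX (measurableSet_singleton false)).inter (hYm (measurableSet_singleton false))
  have hsub : {ω | Y ω = true} ⊆ {ω | f true (N ω) = true} := by
    intro ω hω
    simp only [hY, Set.mem_ofPred_eq] at hω ⊢
    cases hx : X ω <;> rw [hx] at hω
    · exact hMono (N ω) hω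
    · exact hω
  have hinter : {ω | X ω = false ∧ Y ω = false} ∩ {ω | f true (N ω) = true}
      = {ω | f true (N ω) = true} \ {ω | Y ω = true} := by
    ext ω
    simp only [hY, Set.mem_inter_iff, Set.mem_sdiff, Set.mem_ofPred_eq]
    cases hx : X ω <;> simp [and_comm]
  rw [cond_apply hA, hinter,
    measure_sdiff hsub hYset.nullMeasurableSet (measure_ne_top P _), ENNReal.div_eq_inv_mul]
end

section
/- Let (Ω, 𝓕, ℙ) be a probability space, 𝒩 a measurable space, N : Ω → 𝒩 and X : Ω → {0,1} measurable and independent random variables, f : {0,1} × 𝒩 → {0,1} measurable in its second argument, and Y := f(X, N). Assume f is increasing monotonic relative to X, i.e., f(0, n) ≤ f(1, n) for all n ∈ 𝒩. Then the probability of necessity and sufficiency PNS_{1→1} := ℙ(X = 1, Y = 1, f(0, N) = 0) + ℙ(X = 0, Y = 0, f(1, N) = 1) satisfies PNS_{1→1} = ℙ(f(1, N) = 1) − ℙ(f(0, N) = 1); that is, PNS_{1→1} = ℙ^{do(X=1)}(Y = 1) − ℙ^{do(X=0)}(Y = 1). -/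
open MeasureTheory ProbabilityTheory

/-- In the SCM `Y = f(X, N)` with binary `X, Y` (`false = 0`, `true = 1`),
`X ⟂ N`, and `f` increasing monotonic relative to `X` (`f 0 n ≤ f 1 n` for all `n`),
the probability of necessity and sufficiency
`PNS₁→₁ = P(X = 1, Y = 1, f(0, N) = 0) + P(X = 0, Y = 0, f(1, N) = 1)` equals
`P(f(1, N) = 1) − P(f(0, N) = 1)`, i.e. `P^{do(X=1)}(Y = 1) − P^{do(X=0)}(Y = 1)`. -/
theorem pns_increasing
    {Ω 𝒩 : Type*} [MeasurableSpace Ω] [MeasurableSpace 𝒩]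
    (P : Measure Ω) [IsProbabilityMeasure P]
    (N : Ω → 𝒩) (X : Ω → Bool) (hN : Measurable N) (hX : Measurable X)
    (hIndep : IndepFun X N P)
    (f : Bool → 𝒩 → Bool) (hf : ∀ x, Measurable (f x))
    (Y : Ω → Bool) (hY : Y = fun ω => f (X ω) (N ω))
    (hMono : ∀ n, f false n ≤ f true n) :
    P {ω | X ω = true ∧ Y ω = true ∧ f false (N ω) = false}
      + P {ω | X ω = false ∧ Y ω = false ∧ f true (N ω) = true}
      = P {ω | f true (N ω) = true} - P {ω | f false (N ω) = true} := by
  have hsub : {ω | f false (N ω) = true} ⊆ {ω | f true (N ω) = true} := fun ω h =>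
    top_le_iff.mp ((le_of_eq (Eq.symm h)).trans (hMono (N ω)))
  have hmeas : MeasurableSet {ω | f false (N ω) = true} :=
    ((hf false).comp hN) (measurableSet_singleton true)
  have hXmeas : MeasurableSet {ω | X ω = true} := hX (measurableSet_singleton true)
  rw [← measure_sdiff hsub hmeas.nullMeasurableSet (measure_ne_top P _),
    ← measure_inter_add_sdiff ({ω | f true (N ω) = true} \ {ω | f false (N ω) = true}) hXmeas]
  congr 2
  · ext ω
    cases hx : X ω <;> simp [hY, hx]
  · ext ω
    cases hx : X ω <;> simp [hY, hx, and_comm]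
end
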